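/- Let σ ≥ 1 be a natural number and let p, h, s : ℕ → ℕ be sequences satisfying h(n) + s(n) ≤ p(n) for every n ≥ 1; define P(n) = Σ_{k=1}^{n} p(k), H(n) = Σ_{k=1}^{n} h(k), S(n) = Σ_{k=1}^{n} s(k). Suppose that: (a) there is a real number B ≥ 1 such that p(n) ≤ B^n for all n ≥ 1; (b) the sequence of real numbers H(n)/P(n) tends to 1 as n → ∞; and (c) there exist a real ε > 0 and N ∈ ℕ such that S(n+σ) ≥ ε·H(n) for all n > N. Then these assumptions are contradictory (i.e., no such data exist). -/

import Mathlib

open Filter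

/-- The general form of the counting argument of the paper (shift `σ = 17`
gives Theorem 1, shift `σ = 4` gives Theorem 9.1): the stated assumptions on
the counting sequences `p`, `h`, `s` and their partial sums are contradictory. -/
theorem stmt_9 (σ : ℕ) (hσ : 1 ≤ σ) (p h s : ℕ → ℕ)
    (hle : ∀ n ≥ 1, h n + s n ≤ p n)
    (P H S : ℕ → ℕ)
    (hP : ∀ n, P n = ∑ k ∈ Finset.Icc 1 n, p k)
    (hH : ∀ n, H n = ∑ k ∈ Finset.Icc 1 n, h k)
    (hS : ∀ n, S n = ∑ k ∈ Finset.Icc 1 n, s k)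
    (B : ℝ) (hB : 1 ≤ B) (hpB : ∀ n ≥ 1, (p n : ℝ) ≤ B ^ n)
    (hHP : Tendsto (fun n => (H n : ℝ) / (P n : ℝ)) atTop (nhds 1))
    (ε : ℝ) (hε : 0 < ε) (N : ℕ)
    (hSH : ∀ n > N, ε * (H n : ℝ) ≤ (S (n + σ) : ℝ)) :
    False := by
  have hsum : ∀ n, H n + S n ≤ P n := by
    intro n
    rw [hP, hH, hS, ← Finset.sum_add_distrib]
    exact Finset.sum_le_sum fun k hk => hle k (Finset.mem_Icc.1 hk).1
  have hup : ∀ n, (P n : ℝ) ≤ (2 * B) ^ n := by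
    intro n
    rw [hP]
    push_cast
    calc ∑ k ∈ Finset.Icc 1 n, (p k : ℝ) ≤ ∑ k ∈ Finset.Icc 1 n, B ^ n := by
          refine Finset.sum_le_sum fun k hk => ?_
          have hk := Finset.mem_Icc.1 hk
          exact (hpB k hk.1).trans (pow_le_pow_right₀ hB hk.2)
      _ = n * B ^ n := by simp
      _ ≤ 2 ^ n * B ^ n := by
          have : (n : ℝ) ≤ 2 ^ n := by exact_mod_cast Nat.lt_two_pow_self.le
          gcongr
      _ = (2 * B) ^ n := by rw [mul_pow]
  have hD : 0 < (2 * B) ^ σ := by positivity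
  set D := (2 * B) ^ σ with hDdef
  have hδ : 0 < ε / (4 * D) := by positivity
  set δ := ε / (4 * D) with hδdef
  have hδD : δ * (4 * D) = ε := by rw [hδdef]; field_simp
  have e1 := hHP.eventually (lt_mem_nhds (show (1 / 2 : ℝ) < 1 by norm_num))
  have e2 := hHP.eventually (lt_mem_nhds (show (1 - δ : ℝ) < 1 by linarith))
  obtain ⟨M, hM⟩ := eventually_atTop.1 (e1.and (e2.and (eventually_gt_atTop N)))
  have hpos : ∀ n ≥ M, (0 : ℝ) < P n := by
    intro n hn
    rcases Nat.eq_zero_or_pos (P n) with h0 | h0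
    · have := (hM n hn).1
      simp [h0] at this
      linarith
    · exact_mod_cast h0
  have step : ∀ n ≥ M, 2 * D * (P n : ℝ) ≤ P (n + σ) := by
    intro n hn
    have a1 := (lt_div_iff₀ (hpos n hn)).1 (hM n hn).1
    have a2 := (lt_div_iff₀ (hpos (n + σ) (by omega))).1 (hM (n + σ) (by omega)).2.1
    have a3 := hSH n (hM n hn).2.2
    have a4 : (H (n + σ) : ℝ) + S (n + σ) ≤ P (n + σ) := by exact_mod_cast hsum (n + σ)
    have a5 : ε * (1 / 2 * (P n : ℝ)) ≤ ε * H n := by gcongr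
    have a6 : δ * (2 * D * (P n : ℝ)) ≤ δ * P (n + σ) := by
      have : δ * (2 * D * (P n : ℝ)) = ε * (1 / 2 * (P n : ℝ)) := by rw [← hδD]; ring
      linarith
    exact le_of_mul_le_mul_left a6 hδ
  have iter : ∀ j : ℕ, (2 * D) ^ j ≤ (P (M + j * σ) : ℝ) := by
    intro j
    induction j with
    | zero =>
      have := hpos M le_rfl
      have h1 : 1 ≤ P M := by exact_mod_cast this
      simpa using h1
    | succ j ih =>
      have := step (M + j * σ) (by omega)
      rw [show M + (j + 1) * σ = M + j * σ + σ by ring, pow_succ']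
      exact (mul_le_mul_of_nonneg_left ih (by positivity)).trans this
  obtain ⟨j, hj⟩ := pow_unbounded_of_one_lt ((2 * B) ^ M) (show (1 : ℝ) < 2 by norm_num)
  have b := (iter j).trans (hup _)
  rw [pow_add, mul_pow, mul_comm j σ, pow_mul, ← hDdef] at b
  have := le_of_mul_le_mul_right b (by positivity)
  linarith
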